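/- arXiv:2208.06500 — 5 statements merged into one kernel-verified Lean document; each statement's English description precedes it below -/
import Mathlib

section
/- Let φ: ℝ → ℝ and ψ: ℝ → ℝ be C² with ψ'(t) ≥ 0 for all t, and suppose there are constants a ≥ 0 and M ≥ 0 such that |φ''(t)| ≤ a·ψ'(t) and |ψ''(t)| ≤ M for all t ∈ ℝ. Then for all t, t₀ ∈ ℝ: |cos(2π(φ(t₀) + φ'(t₀)(t − t₀))) − cos(2πφ(t))| ≤ π·a·( ψ'(t₀)·(t − t₀)² + (M/3)·|t − t₀|³ ). -/
open Real

lemma aux_bound (g g' B B' : ℝ → ℝ) (hg : ∀ s, HasDerivAt g (g' s) s)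
    (hB : ∀ s, HasDerivAt B (B' s) s) (g0 : g 0 = 0) (B0 : B 0 = 0)
    (h : ∀ s, 0 ≤ s → |g' s| ≤ B' s) (s : ℝ) (hs : 0 ≤ s) : |g s| ≤ B s := by
  have := image_norm_le_of_norm_deriv_right_le_deriv_boundary (f := g) (f' := g') (a := 0) (b := s)
    (B := B) (B' := B') (fun x _ => (hg x).continuousAt.continuousWithinAt)
    (fun x _ => (hg x).hasDerivWithinAt) (by simp [g0, B0]) hB
    (fun x hx => by simpa using h x hx.1)
  simpa using this ⟨hs, le_rfl⟩

lemma aux_dir (φ ψ : ℝ → ℝ) (hφ : ContDiff ℝ 2 φ) (hψ : ContDiff ℝ 2 ψ)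
    (a M : ℝ) (ha : 0 ≤ a)
    (hφ'' : ∀ t, |deriv (deriv φ) t| ≤ a * deriv ψ t)
    (hψ'' : ∀ t, |deriv (deriv ψ) t| ≤ M) (t₀ e : ℝ) (he : |e| = 1) (s : ℝ) (hs : 0 ≤ s) :
    |φ (t₀ + e * s) - φ t₀ - deriv φ t₀ * (e * s)|
      ≤ a * (deriv ψ t₀ * s ^ 2 / 2 + M * s ^ 3 / 6) := by
  have key : ∀ f : ℝ → ℝ, ContDiff ℝ 2 f → (∀ x, HasDerivAt f (deriv f x) x) ∧
      ∀ x, HasDerivAt (deriv f) (deriv (deriv f) x) x := by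
    intro f hf
    refine ⟨fun x => ((hf.differentiable (by norm_num)) x).hasDerivAt, fun x => ?_⟩
    have h1 : ContDiff ℝ 1 (deriv f) :=
      ((contDiff_succ_iff_deriv (n := 1)).1 (by simpa [one_add_one_eq_two] using hf)).2.2
    exact ((h1.differentiable (by norm_num)) x).hasDerivAt
  have lin : ∀ s, HasDerivAt (fun s : ℝ => t₀ + e * s) e s := fun s => by
    simpa using ((hasDerivAt_id s).const_mul e).const_add t₀
  obtain ⟨p1, p2⟩ := key φ hφ
  obtain ⟨q1, q2⟩ := key ψ hψ
  have c : ∀ f f' : ℝ → ℝ, (∀ x, HasDerivAt f (f' x) x) →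
      ∀ s, HasDerivAt (fun s => f (t₀ + e * s)) (f' (t₀ + e * s) * e) s := fun f f' h s =>
    (h (t₀ + e * s)).comp s (lin s)
  have s1 : ∀ s, 0 ≤ s → |deriv ψ (t₀ + e * s) - deriv ψ t₀| ≤ M * s := 
    aux_bound _ _ _ (fun _ => M) (fun s => (c _ _ q2 s).sub_const _)
      (fun s => by simpa using (hasDerivAt_id s).const_mul M) (by simp) (by simp)
      (fun s _ => by simpa [abs_mul, he] using hψ'' _)
  have s2 : ∀ s, 0 ≤ s → |deriv φ (t₀ + e * s) - deriv φ t₀|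
      ≤ a * (deriv ψ t₀ * s + M * s ^ 2 / 2) := by
    refine aux_bound _ _ _ (fun s => a * (deriv ψ t₀ + M * s)) (fun s => (c _ _ p2 s).sub_const _)
      (fun s => ?_) (by simp) (by simp) (fun s h0 => ?_)
    · have := (((hasDerivAt_id s).const_mul (deriv ψ t₀)).add
        ((((hasDerivAt_id s).pow 2).const_mul M).div_const 2)).const_mul a
      refine HasDerivAt.congr_deriv this ?_
      simp [-mul_eq_mul_left_iff]; ring
    · rw [abs_mul, he, mul_one]
      refine (hφ'' _).trans (mul_le_mul_of_nonneg_left ?_ ha)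
      linarith [(abs_le.1 (s1 s h0)).2]
  refine aux_bound (fun s => φ (t₀ + e * s) - φ t₀ - deriv φ t₀ * (e * s))
    (fun s => (deriv φ (t₀ + e * s) - deriv φ t₀) * e)
    (fun s => a * (deriv ψ t₀ * s ^ 2 / 2 + M * s ^ 3 / 6))
    (fun s => a * (deriv ψ t₀ * s + M * s ^ 2 / 2)) (fun s => ?_)
      (fun s => ?_) (by simp) (by simp) (fun s h0 => ?_) s hs
  · have := ((c _ _ p1 s).sub_const (φ t₀)).sub
      (((hasDerivAt_id s).const_mul e).const_mul (deriv φ t₀))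
    refine HasDerivAt.congr_deriv this ?_
    simp [-mul_eq_mul_left_iff]; ring
  · have := (((((hasDerivAt_id s).pow 2).const_mul (deriv ψ t₀)).div_const 2).add
        ((((hasDerivAt_id s).pow 3).const_mul M).div_const 6)).const_mul a
    refine HasDerivAt.congr_deriv this ?_
    simp [-mul_eq_mul_left_iff]; ring
  · rw [abs_mul, he, mul_one]
    exact s2 s h0

/-- Taylor-expansion-of-phase estimate inside a cosine: if `|φ''| ≤ a·ψ'` and `|ψ''| ≤ M`,
then `|cos(2π(φ(t₀) + φ'(t₀)(t − t₀))) − cos(2πφ(t))|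
      ≤ π·a·(ψ'(t₀)·(t − t₀)² + (M/3)·|t − t₀|³)`. -/
theorem cos_phase_linearization_estimate
    (φ ψ : ℝ → ℝ) (hφ : ContDiff ℝ 2 φ) (hψ : ContDiff ℝ 2 ψ)
    (hψ' : ∀ t, 0 ≤ deriv ψ t)
    (a M : ℝ) (ha : 0 ≤ a) (hM : 0 ≤ M)
    (hφ'' : ∀ t, |deriv (deriv φ) t| ≤ a * deriv ψ t)
    (hψ'' : ∀ t, |deriv (deriv ψ) t| ≤ M) :
    ∀ t t₀ : ℝ,
      |Real.cos (2 * π * (φ t₀ + deriv φ t₀ * (t - t₀))) - Real.cos (2 * π * φ t)|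
        ≤ π * a * (deriv ψ t₀ * (t - t₀) ^ 2 + M / 3 * |t - t₀| ^ 3) := by
  intro t t₀
  have R : |φ t - φ t₀ - deriv φ t₀ * (t - t₀)|
      ≤ a * (deriv ψ t₀ * |t - t₀| ^ 2 / 2 + M * |t - t₀| ^ 3 / 6) := by
    have H := aux_dir φ ψ hφ hψ a M ha hφ'' hψ'' t₀
    rcases le_total 0 (t - t₀) with h | h
    · have := H 1 (by simp) _ (abs_nonneg (t - t₀))
      have e : 1 * |t - t₀| = t - t₀ := by rw [abs_of_nonneg h, one_mul]
      rw [e, add_sub_cancel] at this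
      exact this
    · have := H (-1) (by simp) _ (abs_nonneg (t - t₀))
      have e : -1 * |t - t₀| = t - t₀ := by rw [abs_of_nonpos h]; ring
      rw [e, add_sub_cancel] at this
      exact this
  have L : ∀ x y : ℝ, |Real.cos x - Real.cos y| ≤ |x - y| := by
    intro x y
    have := Convex.norm_image_sub_le_of_norm_hasDerivWithin_le (f := Real.cos)
      (f' := fun x => -Real.sin x) (C := 1) (s := Set.univ) (x := y) (y := x)
      (fun x _ => (Real.hasDerivAt_cos x).hasDerivWithinAt)
      (fun x _ => by simpa using Real.abs_sin_le_one x) convex_univ trivial trivial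
    simpa using this
  refine (L _ _).trans ?_
  have e : 2 * π * (φ t₀ + deriv φ t₀ * (t - t₀)) - 2 * π * φ t
      = -(2 * π * (φ t - φ t₀ - deriv φ t₀ * (t - t₀))) := by ring
  rw [e, abs_neg, abs_mul, abs_of_pos Real.two_pi_pos]
  refine (mul_le_mul_of_nonneg_left R Real.two_pi_pos.le).trans (le_of_eq ?_)
  rw [sq_abs]; ring
end

section
/- Let h be a real-valued Schwartz function on ℝ whose Fourier transform ĥ(ξ) = ∫_ℝ h(t) e^{−i2πξt} dt is supported in [−H, H] for some H > 0. Let B ≥ 0, φ₀ ∈ ℝ, t₀ ∈ ℝ and η > H, and define x(u) = B·cos(2π(φ₀ + η(u − t₀))). Then for every ξ ≥ 0: V_x^{(h)}(t₀, ξ) = (B/2)·e^{i2πφ₀}·ĥ(ξ − η). -/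
open Real MeasureTheory
open scoped FourierTransform

/-- Short-time Fourier transform of `x` with window `g`:
`V_x^{(g)}(t, ξ) = ∫ x(u) g(u − t) e^{−i2πξ(u−t)} du`. -/
noncomputable def STFT (g : ℝ → ℝ) (x : ℝ → ℝ) (t ξ : ℝ) : ℂ :=
  ∫ u : ℝ, ((x u * g (u - t) : ℝ) : ℂ) *
    Complex.exp (-(2 * π * Complex.I * ξ * (u - t)))

/-- The STFT of a pure linear-phase cosine `x(u) = B cos(2π(φ₀ + η(u − t₀)))` with a
band-limited real Schwartz window (with `η > H`) equals `(B/2) e^{i2πφ₀} ĥ(ξ − η)`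
for every `ξ ≥ 0`. -/
theorem STFT_of_linear_phase_cosine
    (h : SchwartzMap ℝ ℝ)
    (H : ℝ) (hH : 0 < H)
    (hsupp : ∀ ζ : ℝ, ζ ∉ Set.Icc (-H) H → 𝓕 (fun t : ℝ => (h t : ℂ)) ζ = 0)
    (B φ₀ t₀ η : ℝ) (hB : 0 ≤ B) (hη : H < η)
    (x : ℝ → ℝ) (hx : ∀ u : ℝ, x u = B * Real.cos (2 * π * (φ₀ + η * (u - t₀)))) :
    ∀ ξ : ℝ, 0 ≤ ξ →
      STFT (fun u => h u) x t₀ ξ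
        = (B / 2 : ℂ) * Complex.exp (2 * π * Complex.I * φ₀) *
            𝓕 (fun t : ℝ => (h t : ℂ)) (ξ - η) := by
  intro ξ hξ
  have hF : ∀ ζ : ℝ, 𝓕 (fun t : ℝ => (h t : ℂ)) ζ
      = ∫ v : ℝ, Complex.exp (-(2 * π * Complex.I * ζ * v)) * (h v : ℂ) := by
    intro ζ
    rw [Real.fourier_real_eq_integral_exp_smul]
    congr 1
    funext v
    rw [smul_eq_mul]
    congr 2
    push_cast
    ring
  have hI : ∀ ζ : ℝ, Integrable
      (fun v : ℝ => Complex.exp (-(2 * π * Complex.I * ζ * v)) * (h v : ℂ)) := by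
    intro ζ
    have h1 : Integrable (fun v : ℝ => (h v : ℂ)) := h.integrable.ofReal
    refine h1.bdd_mul (c := 1) (by fun_prop) (Filter.Eventually.of_forall fun v => ?_)
    have : -(2 * π * Complex.I * ζ * v) = ((-(2 * π * ζ * v) : ℝ) : ℂ) * Complex.I := by
      push_cast; ring
    rw [this, Complex.norm_exp_ofReal_mul_I]
  have h0 : 𝓕 (fun t : ℝ => (h t : ℂ)) (ξ + η) = 0 := by
    apply hsupp
    rintro ⟨_, h2⟩
    linarith
  have key : STFT (fun u => h u) x t₀ ξ
      = ∫ v : ℝ, ((B / 2 : ℂ) * Complex.exp (2 * π * Complex.I * φ₀) *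
          (Complex.exp (-(2 * π * Complex.I * (ξ - η : ℝ) * v)) * (h v : ℂ))
        + (B / 2 : ℂ) * Complex.exp (-(2 * π * Complex.I * φ₀)) *
          (Complex.exp (-(2 * π * Complex.I * (ξ + η : ℝ) * v)) * (h v : ℂ))) := by
    unfold STFT
    symm
    rw [← integral_sub_right_eq_self _ t₀]
    symm
    congr 1
    funext u
    rw [hx]
    push_cast
    rw [Complex.cos]
    have e1 : Complex.exp (2 * π * (φ₀ + η * (u - t₀)) * Complex.I)
        * Complex.exp (-(2 * π * Complex.I * ξ * (u - t₀)))
        = Complex.exp (2 * π * Complex.I * φ₀)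
          * Complex.exp (-(2 * π * Complex.I * (ξ - η) * (u - t₀))) := by
      rw [← Complex.exp_add, ← Complex.exp_add]; congr 1; ring
    have e2 : Complex.exp (-(2 * π * (φ₀ + η * (u - t₀))) * Complex.I)
        * Complex.exp (-(2 * π * Complex.I * ξ * (u - t₀)))
        = Complex.exp (-(2 * π * Complex.I * φ₀))
          * Complex.exp (-(2 * π * Complex.I * (ξ + η) * (u - t₀))) := by
      rw [← Complex.exp_add, ← Complex.exp_add]; congr 1; ring
    linear_combination (B / 2 * h (u - t₀) : ℂ) * e1 + (B / 2 * h (u - t₀) : ℂ) * e2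
  rw [key, integral_add ((hI _).const_mul _) ((hI _).const_mul _), integral_const_mul,
    integral_const_mul, ← hF, ← hF, h0, mul_zero, add_zero]
end

section
/- Under the WSFv3 model with no change points, for all t, t₀ ∈ ℝ the linearization error satisfies: | x(t) − Σ_{l≥1} B_l(t₀) cos(2π(φ_l(t₀) + φ_l'(t₀)(t − t₀))) | ≤ (ε/ℓ)·|t − t₀|·( φ_ℓ'(t₀) + (M/2)|t − t₀| )·Σ_{l≥1} c(l) + (πε/ℓ)·|t − t₀|²·( φ_ℓ'(t₀) + (M/3)|t − t₀| )·Σ_{l≥1} l·B_l(t₀). -/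
open Real MeasureTheory

lemma aux0 (g g' : ℝ → ℝ) (hg : ∀ s, HasDerivAt g (g' s) s) (a b d : ℝ)
    (hb : ∀ s, 0 ≤ s → |g' s| ≤ a + b * s + d * s ^ 2) (h : ℝ) (hh : 0 ≤ h) :
    |g h - g 0| ≤ a * h + b * h ^ 2 / 2 + d * h ^ 3 / 3 := by
  have key := image_norm_le_of_norm_deriv_right_le_deriv_boundary
    (f := fun s => g s - g 0) (f' := g') (a := 0) (b := h)
    (B := fun s => a * s + b * s ^ 2 / 2 + d * s ^ 3 / 3)
    (B' := fun s => a + b * s + d * s ^ 2)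
    (fun s _ => ((hg s).sub_const _).continuousAt.continuousWithinAt)
    (fun s _ => ((hg s).sub_const _).hasDerivWithinAt)
    (by simp)
    (by
      intro s
      have h1 := (((hasDerivAt_id s).const_mul a).add
        ((((hasDerivAt_id s).pow 2).const_mul b).div_const 2)).add
        ((((hasDerivAt_id s).pow 3).const_mul d).div_const 3)
      refine h1.congr_deriv ?_
      simp
      ring)
    (by
      intro s hs
      simpa using hb s hs.1)
  simpa using key (Set.right_mem_Icc.2 hh)

lemma aux1 (f f' : ℝ → ℝ) (hf : ∀ s, HasDerivAt f (f' s) s) (t₀ a b d : ℝ)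
    (hb : ∀ s, |f' s| ≤ a + b * |s - t₀| + d * |s - t₀| ^ 2) (t : ℝ) :
    |f t - f t₀| ≤ a * |t - t₀| + b * |t - t₀| ^ 2 / 2 + d * |t - t₀| ^ 3 / 3 := by
  rcases le_total t₀ t with h | h
  · have := aux0 (fun s => f (t₀ + s)) (fun s => f' (t₀ + s))
      (fun s => (hf (t₀ + s)).comp_const_add t₀ s) a b d
      (fun s hs => by simpa [abs_of_nonneg hs] using hb (t₀ + s)) (t - t₀) (by linarith)
    rw [abs_of_nonneg (sub_nonneg.2 h)]
    simpa using this
  · have := aux0 (fun s => f (t₀ - s)) (fun s => -f' (t₀ - s))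
      (fun s => (hf (t₀ - s)).comp_const_sub t₀ s) a b d
      (fun s hs => by simpa [abs_of_nonneg hs] using hb (t₀ - s)) (t₀ - t) (by linarith)
    rw [abs_of_nonpos (sub_nonpos.2 h), neg_sub]
    simpa using this

/-- Lemma 2 of the paper, zeroth-order part in the time domain: under the WSFv3 model
with no change points, the error of replacing each phase by its first-order Taylor
expansion at `t₀` (and freezing the amplitudes at `t₀`) is bounded as stated. -/
theorem WSFv3_linearization_error
    (B : ℕ → ℝ → ℝ) (φ : ℕ → ℝ → ℝ) (x : ℝ → ℝ)
    (hx : ∀ t : ℝ, x t = ∑' l : ℕ, B (l + 1) t * Real.cos (2 * π * φ (l + 1) t))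
    (hBC1 : ∀ l : ℕ, 1 ≤ l → ContDiff ℝ 1 (B l))
    (hBpos : ∀ l : ℕ, 1 ≤ l → ∀ t : ℝ, 0 ≤ B l t)
    (hφC2 : ∀ l : ℕ, 1 ≤ l → ContDiff ℝ 2 (φ l))
    (hφ' : ∀ l : ℕ, 1 ≤ l → ∀ t : ℝ, 0 < deriv (φ l) t)
    (ℓ : ℕ) (hℓ : 1 ≤ ℓ) (hBℓ : ∀ t : ℝ, 0 < B ℓ t)
    (ε M : ℝ) (hε : 0 ≤ ε) (hM : 0 ≤ M)
    (c : ℕ → ℝ) (hc0 : ∀ l : ℕ, 0 ≤ c l)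
    (hcs : Summable (fun l : ℕ => c (l + 1)))
    (hBc : ∀ l : ℕ, 1 ≤ l → ∀ t : ℝ, B l t ≤ c l * B ℓ t)
    (hB' : ∀ l : ℕ, 1 ≤ l → ∀ t : ℝ,
      |deriv (B l) t| ≤ ε * c l * deriv (φ ℓ) t / (ℓ : ℝ))
    (hφ'' : ∀ l : ℕ, 1 ≤ l → ∀ t : ℝ,
      |deriv (deriv (φ l)) t| ≤ ε * (l : ℝ) * deriv (φ ℓ) t / (ℓ : ℝ))
    (hφ''M : ∀ l : ℕ, 1 ≤ l → ∀ t : ℝ, |deriv (deriv (φ l)) t| ≤ M)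
    (hsum : ∀ t : ℝ, Summable (fun l : ℕ => ((l : ℝ) + 1) * B (l + 1) t))
    :
    ∀ t t₀ : ℝ,
      |x t - ∑' l : ℕ, B (l + 1) t₀ *
          Real.cos (2 * π * (φ (l + 1) t₀ + deriv (φ (l + 1)) t₀ * (t - t₀)))|
        ≤ ε / (ℓ : ℝ) * |t - t₀| * (deriv (φ ℓ) t₀ + M / 2 * |t - t₀|) *
            (∑' l : ℕ, c (l + 1))
          + π * ε / (ℓ : ℝ) * |t - t₀| ^ 2 * (deriv (φ ℓ) t₀ + M / 3 * |t - t₀|) *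
              (∑' l : ℕ, ((l : ℝ) + 1) * B (l + 1) t₀) := by
  intro t t₀
  have hL : (0:ℝ) < ℓ := by exact_mod_cast hℓ
  have hd1 : ∀ l : ℕ, 1 ≤ l → ∀ s, HasDerivAt (φ l) (deriv (φ l) s) s := fun l hl s =>
    (((hφC2 l hl).differentiable (by norm_num)) s).hasDerivAt
  have hd2 : ∀ l : ℕ, 1 ≤ l → ∀ s,
      HasDerivAt (deriv (φ l)) (deriv (deriv (φ l)) s) s := fun l hl s => by
    have h2 : ContDiff ℝ 1 (deriv (φ l)) := by
      have := hφC2 l hl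
      rw [show (2 : WithTop ℕ∞) = 1 + 1 by norm_num, contDiff_succ_iff_deriv] at this
      exact this.2.2
    exact ((h2.differentiable (by norm_num)) s).hasDerivAt
  have hBd : ∀ l : ℕ, 1 ≤ l → ∀ s, HasDerivAt (B l) (deriv (B l) s) s := fun l hl s =>
    (((hBC1 l hl).differentiable (by norm_num)) s).hasDerivAt
  set p := deriv (φ ℓ) t₀ with hp
  have hpb : ∀ s, deriv (φ ℓ) s ≤ p + M * |s - t₀| := fun s => by
    have := aux1 _ _ (hd2 ℓ hℓ) t₀ M 0 0 (fun s => by simpa using hφ''M ℓ hℓ s) s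
    have h2 := le_abs_self (deriv (φ ℓ) s - deriv (φ ℓ) t₀)
    simp only [zero_mul, zero_div, add_zero] at this
    linarith
  set h := |t - t₀| with hh
  have hh0 : 0 ≤ h := abs_nonneg _
  have hBb : ∀ l : ℕ, 1 ≤ l → |B l t - B l t₀| ≤ ε / ℓ * h * (p + M / 2 * h) * c l := by
    intro l hl
    have := aux1 _ _ (hBd l hl) t₀ (ε * c l / ℓ * p) (ε * c l / ℓ * M) 0 (fun s => by
      refine (hB' l hl s).trans ?_
      have h0 : 0 ≤ ε * c l / ℓ := div_nonneg (mul_nonneg hε (hc0 l)) hL.le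
      have := mul_le_mul_of_nonneg_left (hpb s) h0
      calc _ = ε * c l / ℓ * deriv (φ ℓ) s := by ring
        _ ≤ _ := this
        _ = _ := by ring) t
    refine this.trans (le_of_eq ?_)
    ring
  have hφb : ∀ l : ℕ, 1 ≤ l → |φ l t - (φ l t₀ + deriv (φ l) t₀ * (t - t₀))| ≤
      ε * l / ℓ * (p * h ^ 2 / 2 + M * h ^ 3 / 6) := by
    intro l hl
    have h0 : 0 ≤ ε * l / ℓ := by positivity
    have h1 := fun s => aux1 _ _ (hd2 l hl) t₀ (ε * l / ℓ * p) (ε * l / ℓ * M) 0 (fun s => by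
      refine (hφ'' l hl s).trans ?_
      have := mul_le_mul_of_nonneg_left (hpb s) h0
      calc _ = ε * l / ℓ * deriv (φ ℓ) s := by ring
        _ ≤ _ := this
        _ = _ := by ring) s
    have h2 := aux1 (fun s => φ l s - deriv (φ l) t₀ * s)
      (fun s => deriv (φ l) s - deriv (φ l) t₀)
      (fun s => by
        exact ((hd1 l hl s).sub ((hasDerivAt_id s).const_mul (deriv (φ l) t₀))).congr_deriv
          (by simp)) t₀ 0
      (ε * l / ℓ * p) (ε * l / ℓ * M / 2) (fun s => (h1 s).trans (le_of_eq (by ring))) t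
    calc _ = |φ l t - deriv (φ l) t₀ * t - (φ l t₀ - deriv (φ l) t₀ * t₀)| := by
          congr 1; ring
      _ ≤ _ := h2
      _ = _ := by rw [← hh]; ring
  have hcos : ∀ u v : ℝ, |Real.cos u - Real.cos v| ≤ |u - v| := fun u v => by
    simpa [Real.dist_eq] using Real.lipschitzWith_cos.dist_le_mul u v
  have hterm : ∀ l : ℕ, 1 ≤ l → |B l t * Real.cos (2 * π * φ l t) -
      B l t₀ * Real.cos (2 * π * (φ l t₀ + deriv (φ l) t₀ * (t - t₀)))| ≤
      ε / ℓ * h * (p + M / 2 * h) * c l +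
      π * ε / ℓ * h ^ 2 * (p + M / 3 * h) * (l * B l t₀) := by
    intro l hl
    set v := φ l t₀ + deriv (φ l) t₀ * (t - t₀)
    have e : B l t * Real.cos (2 * π * φ l t) - B l t₀ * Real.cos (2 * π * v) =
        (B l t - B l t₀) * Real.cos (2 * π * φ l t) +
        B l t₀ * (Real.cos (2 * π * φ l t) - Real.cos (2 * π * v)) := by ring
    rw [e]
    refine (abs_add_le _ _).trans (add_le_add ?_ ?_)
    · rw [abs_mul]
      exact (mul_le_of_le_one_right (abs_nonneg _) (Real.abs_cos_le_one _)).trans (hBb l hl)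
    · rw [abs_mul, abs_of_nonneg (hBpos l hl t₀)]
      have h3 : |Real.cos (2 * π * φ l t) - Real.cos (2 * π * v)| ≤
          2 * π * (ε * l / ℓ * (p * h ^ 2 / 2 + M * h ^ 3 / 6)) := by
        refine (hcos _ _).trans ?_
        rw [← mul_sub, abs_mul, abs_of_pos Real.two_pi_pos]
        exact mul_le_mul_of_nonneg_left (hφb l hl) Real.two_pi_pos.le
      refine (mul_le_mul_of_nonneg_left h3 (hBpos l hl t₀)).trans (le_of_eq ?_)
      ring
  have hBs : ∀ s, Summable (fun l : ℕ => B (l + 1) s) := fun s =>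
    Summable.of_nonneg_of_le (fun l => hBpos _ (by omega) s) (fun l => by
      have := hBpos (l + 1) (by omega) s
      have h4 : (0:ℝ) ≤ l := Nat.cast_nonneg l
      nlinarith) (hsum s)
  have hs : ∀ s (w : ℕ → ℝ), Summable (fun l : ℕ => B (l + 1) s * Real.cos (w l)) :=
    fun s w => Summable.of_norm_bounded (hBs s) (fun l => by
      rw [Real.norm_eq_abs, abs_mul, abs_of_nonneg (hBpos (l + 1) (by omega) s)]
      exact mul_le_of_le_one_right (hBpos (l + 1) (by omega) s) (Real.abs_cos_le_one _))
  rw [hx, ← (hs t _).tsum_sub (hs t₀ _), ← tsum_mul_left, ← tsum_mul_left,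
    ← (hcs.mul_left _).tsum_add ((hsum t₀).mul_left _), ← Real.norm_eq_abs]
  refine tsum_of_norm_bounded ((hcs.mul_left _).add ((hsum t₀).mul_left _)).hasSum ?_
  intro l
  have := hterm (l + 1) (by omega)
  push_cast at this
  exact this
end

section
/- Under the WSFv3 model with no change points, for every t₀ ∈ ℝ and every ξ ≥ 0: | V_x^{(h)}(t₀, ξ) − (1/2) Σ_{l≥1} B_l(t₀) e^{i2πφ_l(t₀)} ĥ(ξ − φ_l'(t₀)) | ≤ ε·[ (1/ℓ)( φ_ℓ'(t₀) m₁ + M m₂/2 ) Σ_{l≥1} c(l) + (π/ℓ)( φ_ℓ'(t₀) m₂ + M m₃/3 ) Σ_{l≥1} l·B_l(t₀) ]. -/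
open Real MeasureTheory
open scoped FourierTransform

lemma aux_taylor_pos (g g' : ℝ → ℝ) (hg : ∀ x, HasDerivAt g (g' x) x) (h0 : g 0 = 0)
    (a b : ℝ) (n : ℕ) (hb : ∀ x, |g' x| ≤ a * |x| ^ n + b * |x| ^ (n + 1)) (x : ℝ) (hx : 0 ≤ x) :
    |g x| ≤ a * |x| ^ (n + 1) / (n + 1) + b * |x| ^ (n + 2) / (n + 2) := by
  have key := image_norm_le_of_norm_deriv_right_le_deriv_boundary (f := g) (f' := g')
    (a := 0) (b := x) (B := fun y => a * y ^ (n + 1) / (n + 1) + b * y ^ (n + 2) / (n + 2))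
    (B' := fun y => a * y ^ n + b * y ^ (n + 1))
    (fun y _ => (hg y).continuousAt.continuousWithinAt) (fun y _ => (hg y).hasDerivWithinAt)
    (by simp [h0]) (fun y => by
      have h1 := ((hasDerivAt_pow (n + 1) y).const_mul a).div_const ((n : ℝ) + 1)
      have h2 := ((hasDerivAt_pow (n + 2) y).const_mul b).div_const ((n : ℝ) + 2)
      convert! h1.add h2 using 1
      have e1 : (n : ℝ) + 1 ≠ 0 := by positivity
      have e2 : (n : ℝ) + 2 ≠ 0 := by positivity
      rw [show n + 1 - 1 = n from rfl, show n + 2 - 1 = n + 1 from rfl]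
      push_cast
      field_simp)
    (fun y hy => by
      have := hb y
      rw [abs_of_nonneg hy.1] at this
      exact this)
  have := key (x := x) ⟨hx, le_refl x⟩
  rw [abs_of_nonneg hx]
  exact this

lemma aux_taylor (g g' : ℝ → ℝ) (hg : ∀ x, HasDerivAt g (g' x) x) (h0 : g 0 = 0)
    (a b : ℝ) (n : ℕ) (hb : ∀ x, |g' x| ≤ a * |x| ^ n + b * |x| ^ (n + 1)) (x : ℝ) :
    |g x| ≤ a * |x| ^ (n + 1) / (n + 1) + b * |x| ^ (n + 2) / (n + 2) := by
  rcases le_total 0 x with hx | hx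
  · exact aux_taylor_pos g g' hg h0 a b n hb x hx
  · have := aux_taylor_pos (fun y => g (-y)) (fun y => -g' (-y))
      (fun y => by
        have := (hg (-y)).comp y (hasDerivAt_neg y)
        simpa [Function.comp_def] using! this)
      (by simpa using h0) a b n (fun y => by simpa using hb (-y)) (-x) (by linarith)
    simpa using this

lemma aux_int (h : SchwartzMap ℝ ℝ) (k : ℕ) : Integrable (fun t : ℝ => |h t| * |t| ^ k) := by
  have := h.integrable_pow_mul volume k
  simpa [mul_comm] using this

lemma aux_bound_int (h : SchwartzMap ℝ ℝ) (m : ℕ → ℝ)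
    (hm : ∀ k : ℕ, m k = ∫ t : ℝ, |h t| * |t| ^ k) (p q r s : ℝ) :
    Integrable (fun τ : ℝ => (p + q * |τ| + r * |τ| ^ 2 + s * |τ| ^ 3) * |h τ|) ∧
    ∫ τ : ℝ, (p + q * |τ| + r * |τ| ^ 2 + s * |τ| ^ 3) * |h τ|
      = p * m 0 + q * m 1 + r * m 2 + s * m 3 := by
  have e : (fun τ : ℝ => (p + q * |τ| + r * |τ| ^ 2 + s * |τ| ^ 3) * |h τ|)
      = fun τ => p * (|h τ| * |τ| ^ 0) + q * (|h τ| * |τ| ^ 1) + r * (|h τ| * |τ| ^ 2)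
        + s * (|h τ| * |τ| ^ 3) := by
    funext τ; ring
  have i0 := (aux_int h 0).const_mul p
  have i1 := (aux_int h 1).const_mul q
  have i2 := (aux_int h 2).const_mul r
  have i3 := (aux_int h 3).const_mul s
  have j1 : Integrable (fun τ : ℝ => p * (|h τ| * |τ| ^ 0) + q * (|h τ| * |τ| ^ 1)) := i0.add i1
  have j2 : Integrable (fun τ : ℝ => p * (|h τ| * |τ| ^ 0) + q * (|h τ| * |τ| ^ 1)
      + r * (|h τ| * |τ| ^ 2)) := j1.add i2
  rw [e]
  refine ⟨j2.add i3, ?_⟩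
  rw [integral_add j2 i3, integral_add j1 i2, integral_add i0 i1]
  simp only [integral_const_mul, ← hm]

lemma norm_char (ξ τ : ℝ) : ‖Complex.exp (-(2 * π * Complex.I * ξ * τ))‖ = 1 := by
  have : (-(2 * π * Complex.I * ξ * τ) : ℂ) = ((-(2 * π * ξ * τ) : ℝ) : ℂ) * Complex.I := by
    push_cast; ring
  rw [this, Complex.norm_exp_ofReal_mul_I]

lemma aux_frozen (h : SchwartzMap ℝ ℝ) (ξ b P p' : ℝ)
    (hz : 𝓕 (fun u : ℝ => (h u : ℂ)) (ξ + p') = 0) :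
    ∫ τ : ℝ, ((b * Real.cos (2 * π * (P + p' * τ)) * h τ : ℝ) : ℂ) *
      Complex.exp (-(2 * π * Complex.I * ξ * τ))
    = (1 / 2 : ℂ) * ((b : ℂ) * Complex.exp (2 * π * Complex.I * (P : ℝ)) *
      𝓕 (fun u : ℝ => (h u : ℂ)) (ξ - p')) := by
  have hI : Integrable (fun u : ℝ => (h u : ℂ)) := h.integrable.ofReal
  have hJ : ∀ w : ℝ, Integrable
      (fun v : ℝ => Complex.exp (↑(-2 * π * v * w) * Complex.I) • (h v : ℂ)) := by
    intro w
    refine hI.norm.mono' ?_ (Filter.Eventually.of_forall fun v => ?_)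
    · exact Continuous.aestronglyMeasurable (by have := h.continuous; fun_prop)
    · rw [norm_smul, Complex.norm_exp_ofReal_mul_I, one_mul]
  have e : (fun τ : ℝ => ((b * Real.cos (2 * π * (P + p' * τ)) * h τ : ℝ) : ℂ) *
      Complex.exp (-(2 * π * Complex.I * ξ * τ))) = fun τ : ℝ =>
      ((1 / 2 : ℂ) * ((b : ℂ) * Complex.exp (2 * π * Complex.I * (P : ℝ)))) *
        (Complex.exp (↑(-2 * π * τ * (ξ - p')) * Complex.I) • (h τ : ℂ)) +
      ((1 / 2 : ℂ) * ((b : ℂ) * Complex.exp (-(2 * π * Complex.I * (P : ℝ))))) *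
        (Complex.exp (↑(-2 * π * τ * (ξ + p')) * Complex.I) • (h τ : ℂ)) := by
    funext τ
    have h1 : Complex.exp (2 * π * Complex.I * (P : ℝ)) *
        Complex.exp (↑(-2 * π * τ * (ξ - p')) * Complex.I) =
        Complex.exp ((2 * π * (P + p' * τ)) * Complex.I) *
          Complex.exp (-(2 * π * Complex.I * ξ * τ)) := by
      rw [← Complex.exp_add, ← Complex.exp_add]; congr 1; push_cast; ring
    have h2 : Complex.exp (-(2 * π * Complex.I * (P : ℝ))) *
        Complex.exp (↑(-2 * π * τ * (ξ + p')) * Complex.I) =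
        Complex.exp (-(2 * π * (P + p' * τ)) * Complex.I) *
          Complex.exp (-(2 * π * Complex.I * ξ * τ)) := by
      rw [← Complex.exp_add, ← Complex.exp_add]; congr 1; push_cast; ring
    simp only [smul_eq_mul]
    rw [Complex.ofReal_mul, Complex.ofReal_mul, Complex.ofReal_cos, Complex.cos]
    push_cast at h1 h2 ⊢
    linear_combination (-(1 / 2 : ℂ) * b * h τ) * h1 + (-(1 / 2 : ℂ) * b * h τ) * h2
  rw [e, integral_add ((hJ _).const_mul _) ((hJ _).const_mul _), integral_const_mul,
    integral_const_mul, ← Real.fourier_real_eq_integral_exp_smul,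
    ← Real.fourier_real_eq_integral_exp_smul, hz]
  ring

lemma aux_term (h : SchwartzMap ℝ ℝ) (m : ℕ → ℝ)
    (hm : ∀ k : ℕ, m k = ∫ t : ℝ, |h t| * |t| ^ k)
    (b p : ℝ → ℝ) (hb : Continuous b) (hp : Continuous p) (t₀ ξ p' C L a M : ℝ)
    (hb0 : 0 ≤ b t₀)
    (hz : 𝓕 (fun u : ℝ => (h u : ℂ)) (ξ + p') = 0)
    (D1 : ∀ τ, |b (τ + t₀) - b t₀| ≤ C * (a * |τ| + M * |τ| ^ 2 / 2))
    (D2 : ∀ τ, |p (τ + t₀) - p t₀ - p' * τ| ≤ L * (a * |τ| ^ 2 / 2 + M * |τ| ^ 3 / 6)) :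
    Integrable (fun τ : ℝ => ((b (τ + t₀) * Real.cos (2 * π * p (τ + t₀)) * h τ : ℝ) : ℂ) *
      Complex.exp (-(2 * π * Complex.I * ξ * τ))) ∧
    (∫ τ : ℝ, ‖((b (τ + t₀) * Real.cos (2 * π * p (τ + t₀)) * h τ : ℝ) : ℂ) *
      Complex.exp (-(2 * π * Complex.I * ξ * τ))‖) ≤ b t₀ * m 0 + C * (a * m 1 + M * m 2 / 2) ∧
    ‖(∫ τ : ℝ, ((b (τ + t₀) * Real.cos (2 * π * p (τ + t₀)) * h τ : ℝ) : ℂ) *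
      Complex.exp (-(2 * π * Complex.I * ξ * τ))) -
      (1 / 2 : ℂ) * ((b t₀ : ℂ) * Complex.exp (2 * π * Complex.I * (p t₀ : ℝ)) *
      𝓕 (fun u : ℝ => (h u : ℂ)) (ξ - p'))‖ ≤
      C * (a * m 1 + M * m 2 / 2) + π * L * b t₀ * (a * m 2 + M * m 3 / 3) := by
  have hc := h.continuous
  have bF : ∀ τ : ℝ, ‖((b (τ + t₀) * Real.cos (2 * π * p (τ + t₀)) * h τ : ℝ) : ℂ) *
      Complex.exp (-(2 * π * Complex.I * ξ * τ))‖ ≤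
      (b t₀ + (C * a) * |τ| + (C * M / 2) * |τ| ^ 2 + 0 * |τ| ^ 3) * |h τ| := by
    intro τ
    rw [norm_mul, norm_char, mul_one, Complex.norm_real, Real.norm_eq_abs, abs_mul, abs_mul]
    gcongr
    have h1 := D1 τ
    have h2 := Real.abs_cos_le_one (2 * π * p (τ + t₀))
    have h3 : |b (τ + t₀)| ≤ b t₀ + |b (τ + t₀) - b t₀| := by
      have := abs_add_le (b (τ + t₀) - b t₀) (b t₀)
      rw [abs_of_nonneg hb0] at this
      rw [sub_add_cancel] at this
      linarith
    have h4 := mul_le_of_le_one_right (abs_nonneg (b (τ + t₀))) h2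
    nlinarith
  have bG : ∀ τ : ℝ, ‖((b t₀ * Real.cos (2 * π * (p t₀ + p' * τ)) * h τ : ℝ) : ℂ) *
      Complex.exp (-(2 * π * Complex.I * ξ * τ))‖ ≤
      (b t₀ + 0 * |τ| + 0 * |τ| ^ 2 + 0 * |τ| ^ 3) * |h τ| := by
    intro τ
    rw [norm_mul, norm_char, mul_one, Complex.norm_real, Real.norm_eq_abs, abs_mul, abs_mul]
    gcongr
    rw [abs_of_nonneg hb0]
    have := mul_le_of_le_one_right hb0 (Real.abs_cos_le_one (2 * π * (p t₀ + p' * τ)))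
    linarith
  obtain ⟨iF, eF⟩ := aux_bound_int h m hm (b t₀) (C * a) (C * M / 2) 0
  obtain ⟨iG, -⟩ := aux_bound_int h m hm (b t₀) 0 0 0
  obtain ⟨iD, eD⟩ := aux_bound_int h m hm 0 (C * a) (C * M / 2 + π * L * b t₀ * a)
    (π * L * b t₀ * M / 3)
  have F := iF.mono' (Continuous.aestronglyMeasurable (by fun_prop))
    (Filter.Eventually.of_forall bF)
  have G := iG.mono' (Continuous.aestronglyMeasurable (by fun_prop))
    (Filter.Eventually.of_forall bG)
  refine ⟨F, ?_, ?_⟩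
  · refine (integral_mono F.norm iF bF).trans ?_
    rw [eF]; apply le_of_eq; ring
  · rw [← aux_frozen h ξ (b t₀) (p t₀) p' hz, ← integral_sub F G]
    refine (norm_integral_le_of_norm_le iD (Filter.Eventually.of_forall fun τ => ?_)).trans ?_
    · rw [← sub_mul, norm_mul, norm_char, mul_one, ← Complex.ofReal_sub, Complex.norm_real,
        Real.norm_eq_abs, ← sub_mul, abs_mul]
      gcongr
      have h1 := D1 τ
      have h2 := Real.abs_cos_le_one (2 * π * p (τ + t₀))
      have h3 : |Real.cos (2 * π * p (τ + t₀)) - Real.cos (2 * π * (p t₀ + p' * τ))|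
          ≤ 2 * π * |p (τ + t₀) - p t₀ - p' * τ| := by
        refine (Real.abs_cos_sub_cos_le _ _).trans ?_
        rw [← mul_sub, abs_mul, abs_of_nonneg (by positivity)]
        apply le_of_eq; congr 2; ring
      have h4 := D2 τ
      have h5 : b (τ + t₀) * Real.cos (2 * π * p (τ + t₀)) -
          b t₀ * Real.cos (2 * π * (p t₀ + p' * τ)) =
          (b (τ + t₀) - b t₀) * Real.cos (2 * π * p (τ + t₀)) + b t₀ *
          (Real.cos (2 * π * p (τ + t₀)) - Real.cos (2 * π * (p t₀ + p' * τ))) := by ring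
      rw [h5]
      refine (abs_add_le _ _).trans ?_
      rw [abs_mul, abs_mul, abs_of_nonneg hb0]
      have h6 := mul_le_of_le_one_right (abs_nonneg (b (τ + t₀) - b t₀)) h2
      have h7 : b t₀ * |Real.cos (2 * π * p (τ + t₀)) - Real.cos (2 * π * (p t₀ + p' * τ))|
          ≤ b t₀ * (2 * π * (L * (a * |τ| ^ 2 / 2 + M * |τ| ^ 3 / 6))) := by
        gcongr
        exact h3.trans (by gcongr)
      nlinarith
    · rw [eD]; apply le_of_eq; ring


/-- Lemma 2, first estimate: STFT approximation of a WSFv3 signal with no change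
points by the sum of frozen harmonic contributions. -/
theorem WSFv3_STFT_approx
    (B : ℕ → ℝ → ℝ) (φ : ℕ → ℝ → ℝ) (x : ℝ → ℝ)
    (hx : ∀ t : ℝ, x t = ∑' l : ℕ, B (l + 1) t * Real.cos (2 * π * φ (l + 1) t))
    (hBC1 : ∀ l : ℕ, 1 ≤ l → ContDiff ℝ 1 (B l))
    (hBpos : ∀ l : ℕ, 1 ≤ l → ∀ t : ℝ, 0 ≤ B l t)
    (hφC2 : ∀ l : ℕ, 1 ≤ l → ContDiff ℝ 2 (φ l))
    (hφ' : ∀ l : ℕ, 1 ≤ l → ∀ t : ℝ, 0 < deriv (φ l) t)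
    (ℓ : ℕ) (hℓ : 1 ≤ ℓ) (hBℓ : ∀ t : ℝ, 0 < B ℓ t)
    (ε M : ℝ) (hε : 0 ≤ ε) (hM : 0 ≤ M)
    (c : ℕ → ℝ) (hc0 : ∀ l : ℕ, 0 ≤ c l)
    (hcs : Summable (fun l : ℕ => c (l + 1)))
    (hBc : ∀ l : ℕ, 1 ≤ l → ∀ t : ℝ, B l t ≤ c l * B ℓ t)
    (hB' : ∀ l : ℕ, 1 ≤ l → ∀ t : ℝ,
      |deriv (B l) t| ≤ ε * c l * deriv (φ ℓ) t / (ℓ : ℝ))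
    (hφ'' : ∀ l : ℕ, 1 ≤ l → ∀ t : ℝ,
      |deriv (deriv (φ l)) t| ≤ ε * (l : ℝ) * deriv (φ ℓ) t / (ℓ : ℝ))
    (hφ''M : ∀ l : ℕ, 1 ≤ l → ∀ t : ℝ, |deriv (deriv (φ l)) t| ≤ M)
    (hsum : ∀ t : ℝ, Summable (fun l : ℕ => ((l : ℝ) + 1) * B (l + 1) t))
    (h : SchwartzMap ℝ ℝ) (hne : h ≠ 0) (heven : ∀ t : ℝ, h (-t) = h t)
    (H : ℝ) (hH : 0 < H)
    (hsupp : ∀ ζ : ℝ, ζ ∉ Set.Icc (-H) H → 𝓕 (fun t : ℝ => (h t : ℂ)) ζ = 0)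
    (hsep1 : ∀ t : ℝ, H < deriv (φ 1) t)
    (hsep : ∀ j : ℕ, 1 ≤ j → ∀ t : ℝ,
      2 * H < deriv (φ (j + 1)) t - deriv (φ j) t)
    (m : ℕ → ℝ) (hm : ∀ k : ℕ, m k = ∫ t : ℝ, |h t| * |t| ^ k) :
    ∀ t₀ : ℝ, ∀ ξ : ℝ, 0 ≤ ξ →
      ‖STFT (fun u => h u) x t₀ ξ
          - (1 / 2 : ℂ) * ∑' l : ℕ, (B (l + 1) t₀ : ℂ) *
              Complex.exp (2 * π * Complex.I * (φ (l + 1) t₀ : ℝ)) *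
              𝓕 (fun u : ℝ => (h u : ℂ)) (ξ - deriv (φ (l + 1)) t₀)‖
        ≤ ε * (1 / (ℓ : ℝ) * (deriv (φ ℓ) t₀ * m 1 + M * m 2 / 2) *
              (∑' l : ℕ, c (l + 1))
            + π / (ℓ : ℝ) * (deriv (φ ℓ) t₀ * m 2 + M * m 3 / 3) *
                (∑' l : ℕ, ((l : ℝ) + 1) * B (l + 1) t₀)) := by
  intro t₀ ξ hξ
  have hℓ0 : (0 : ℝ) < ℓ := by exact_mod_cast hℓ
  -- derivative facts
  have dB : ∀ l : ℕ, 1 ≤ l → ∀ t, HasDerivAt (B l) (deriv (B l) t) t := fun l hl t =>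
    ((hBC1 l hl).differentiable (by norm_num) t).hasDerivAt
  have dφ : ∀ l : ℕ, 1 ≤ l → ∀ t, HasDerivAt (φ l) (deriv (φ l) t) t := fun l hl t =>
    ((hφC2 l hl).differentiable (by norm_num) t).hasDerivAt
  have ddφ : ∀ l : ℕ, 1 ≤ l → ∀ t, HasDerivAt (deriv (φ l)) (deriv (deriv (φ l)) t) t := by
    intro l hl t
    have h2 : ContDiff ℝ (1 + 1) (φ l) := by
      have := hφC2 l hl
      norm_num
      exact this
    have := (contDiff_succ_iff_deriv.1 h2).2.2
    exact (this.differentiable (by norm_num) t).hasDerivAt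
  have sd : ∀ (f f' : ℝ → ℝ), (∀ t, HasDerivAt f (f' t) t) → ∀ τ,
      HasDerivAt (fun s => f (s + t₀)) (f' (τ + t₀)) τ := by
    intro f f' hf τ
    exact (hf (τ + t₀)).comp_add_const τ t₀
  have φℓb : ∀ τ, deriv (φ ℓ) (τ + t₀) ≤ deriv (φ ℓ) t₀ + M * |τ| := by
    intro τ
    have := aux_taylor (fun s => deriv (φ ℓ) (s + t₀) - deriv (φ ℓ) t₀)
      (fun s => deriv (deriv (φ ℓ)) (s + t₀))
      (fun s => (sd _ _ (ddφ ℓ hℓ) s).sub_const _) (by simp) M 0 0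
      (fun s => by simpa using hφ''M ℓ hℓ (s + t₀)) τ
    simp at this
    linarith [(abs_le.1 this).2]
  set a := deriv (φ ℓ) t₀ with ha
  have D1 : ∀ l : ℕ, 1 ≤ l → ∀ τ, |B l (τ + t₀) - B l t₀| ≤
      (ε / ℓ * c l) * (a * |τ| + M * |τ| ^ 2 / 2) := by
    intro l hl τ
    have := aux_taylor (fun s => B l (s + t₀) - B l t₀) (fun s => deriv (B l) (s + t₀))
      (fun s => (sd _ _ (dB l hl) s).sub_const _) (by simp)
      (ε / ℓ * c l * a) (ε / ℓ * c l * M) 0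
      (fun s => by
        refine (hB' l hl (s + t₀)).trans ?_
        have h1 : 0 ≤ ε / ℓ * c l := mul_nonneg (by positivity) (hc0 l)
        have h2 := mul_le_mul_of_nonneg_left (φℓb s) h1
        calc _ = ε / ℓ * c l * deriv (φ ℓ) (s + t₀) := by ring
          _ ≤ _ := h2
          _ = _ := by ring) τ
    refine this.trans (le_of_eq ?_)
    push_cast; ring
  have D2 : ∀ l : ℕ, 1 ≤ l → ∀ τ, |φ l (τ + t₀) - φ l t₀ - deriv (φ l) t₀ * τ| ≤
      (ε / ℓ * l) * (a * |τ| ^ 2 / 2 + M * |τ| ^ 3 / 6) := by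
    intro l hl τ
    have h1 := aux_taylor (fun s => deriv (φ l) (s + t₀) - deriv (φ l) t₀)
      (fun s => deriv (deriv (φ l)) (s + t₀))
      (fun s => (sd _ _ (ddφ l hl) s).sub_const _) (by simp)
      (ε / ℓ * l * a) (ε / ℓ * l * M) 0
      (fun s => by
        refine (hφ'' l hl (s + t₀)).trans ?_
        have h1 : 0 ≤ ε / ℓ * l := by positivity
        have h2 := mul_le_mul_of_nonneg_left (φℓb s) h1
        calc _ = ε / ℓ * l * deriv (φ ℓ) (s + t₀) := by ring
          _ ≤ _ := h2
          _ = _ := by ring)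
    have h2 := aux_taylor (fun s => φ l (s + t₀) - φ l t₀ - deriv (φ l) t₀ * s)
      (fun s => deriv (φ l) (s + t₀) - deriv (φ l) t₀)
      (fun s => by
        have := ((sd _ _ (dφ l hl) s).sub_const (φ l t₀)).sub
          ((hasDerivAt_id s).const_mul (deriv (φ l) t₀))
        simpa using! this) (by simp)
      (ε / ℓ * l * a) (ε / ℓ * l * M / 2) 1
      (fun s => (h1 s).trans (le_of_eq (by push_cast; ring))) τ
    refine h2.trans (le_of_eq ?_)
    push_cast; ring
  have hgt : ∀ l : ℕ, 1 ≤ l → H < deriv (φ l) t₀ := by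
    intro l hl
    induction l, hl using Nat.le_induction with
    | base => exact hsep1 t₀
    | succ n hn ih => have := hsep n hn t₀; linarith
  have T := fun l : ℕ => aux_term h m hm (B (l + 1)) (φ (l + 1))
    (hBC1 _ (by omega)).continuous (hφC2 _ (by omega)).continuous t₀ ξ (deriv (φ (l + 1)) t₀)
    (ε / ℓ * c (l + 1)) (ε / ℓ * (l + 1 : ℕ)) a M (hBpos _ (by omega) _)
    (hsupp _ (fun hh => by have := hgt (l + 1) (by omega); linarith [hh.2]))
    (D1 _ (by omega)) (D2 _ (by omega))
  have sB : ∀ t, Summable (fun l : ℕ => B (l + 1) t) := fun t =>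
    Summable.of_nonneg_of_le (fun l => hBpos _ (by omega) _)
      (fun l => hBc (l + 1) (by omega) t) (hcs.mul_right _)
  set F : ℕ → ℝ → ℂ := fun l τ =>
    ((B (l + 1) (τ + t₀) * Real.cos (2 * π * φ (l + 1) (τ + t₀)) * h τ : ℝ) : ℂ) *
      Complex.exp (-(2 * π * Complex.I * ξ * τ)) with hF
  have sN : Summable (fun l => ∫ τ, ‖F l τ‖) := by
    refine Summable.of_nonneg_of_le (fun l => integral_nonneg fun τ => norm_nonneg _)
      (fun l => (T l).2.1) ?_
    exact ((sB t₀).mul_right _).add ((hcs.mul_left _).mul_right _)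
  have HS := hasSum_integral_of_summable_integral_norm (fun l => (T l).1) sN
  have eST : STFT (fun u => h u) x t₀ ξ = ∫ τ, ∑' l, F l τ := by
    unfold STFT
    rw [← integral_add_right_eq_self _ t₀]
    congr 1
    funext τ
    rw [tsum_mul_right]
    have : (τ + t₀ : ℝ) - t₀ = τ := by ring
    rw [this]
    have : ((τ + t₀ : ℝ) : ℂ) - t₀ = τ := by push_cast; ring
    rw [this, hx, ← Complex.ofReal_tsum, tsum_mul_right]
  have sG : Summable (fun l : ℕ => (1 / 2 : ℂ) * ((B (l + 1) t₀ : ℂ) *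
      Complex.exp (2 * π * Complex.I * (φ (l + 1) t₀ : ℝ)) *
      𝓕 (fun u : ℝ => (h u : ℂ)) (ξ - deriv (φ (l + 1)) t₀))) := by
    apply Summable.mul_left
    refine Summable.of_norm_bounded (g := fun l => B (l + 1) t₀ * m 0)
      ((sB t₀).mul_right _) (fun l => ?_)
    have e1 : ‖Complex.exp (2 * π * Complex.I * (φ (l + 1) t₀ : ℝ))‖ = 1 := by
      have := norm_char (-1) (φ (l + 1) t₀)
      simpa using this
    rw [norm_mul, norm_mul, e1, mul_one, Complex.norm_real, Real.norm_eq_abs,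
      abs_of_nonneg (hBpos _ (by omega) _)]
    refine mul_le_mul_of_nonneg_left ?_ (hBpos _ (by omega) _)
    rw [Real.fourier_real_eq_integral_exp_smul]
    refine (norm_integral_le_integral_norm _).trans (le_of_eq ?_)
    rw [hm]
    congr 1
    funext v
    rw [norm_smul, Complex.norm_exp_ofReal_mul_I]
    simp
  rw [eST, ← HS.tsum_eq, ← tsum_mul_left, ← HS.summable.tsum_sub sG]
  have hs : HasSum (fun l : ℕ => (ε / ℓ * c (l + 1)) * (a * m 1 + M * m 2 / 2) +
      π * (ε / ℓ * (l + 1 : ℕ)) * B (l + 1) t₀ * (a * m 2 + M * m 3 / 3))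
      (ε * (1 / (ℓ : ℝ) * (a * m 1 + M * m 2 / 2) * (∑' l : ℕ, c (l + 1))
            + π / (ℓ : ℝ) * (a * m 2 + M * m 3 / 3) *
                (∑' l : ℕ, ((l : ℝ) + 1) * B (l + 1) t₀))) := by
    have := ((hcs.hasSum.mul_left (1 / (ℓ : ℝ) * (a * m 1 + M * m 2 / 2))).add
      ((hsum t₀).hasSum.mul_left (π / (ℓ : ℝ) * (a * m 2 + M * m 3 / 3)))).mul_left ε
    convert! this using 1
    funext l
    push_cast; ring
  exact tsum_of_norm_bounded hs (fun l => (T l).2.2)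
end

section
/- Let φ, φ̃: ℝ → ℝ be C² strictly increasing bijections, and let H > 0, α ≥ 0, β ≥ 0, γ ≥ 0, γ̃ ≥ 0 be constants such that for all s ∈ ℝ: φ̃'(s) ≥ H, |φ(s) − φ̃(s)| ≤ α, |φ'(s) − φ̃'(s)| ≤ β, |φ''(s)| ≤ γ, and |φ̃''(s)| ≤ γ̃. Then the warped phase θ := φ ∘ φ̃⁻¹ is C² and satisfies, for all t ∈ ℝ: |θ(t) − t| ≤ α, |θ'(t) − 1| ≤ β/H, and |θ''(t)| ≤ ( γ + γ̃·θ'(t) ) / H². -/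
open Real

/-- Theorem 2 (warping step), quantitative form: if `φ̃` is a `C²` strictly increasing
bijection with `φ̃' ≥ H > 0` that approximates a `C²` strictly increasing bijection `φ`
to accuracy `α` (values), `β` (derivatives), with `|φ''| ≤ γ` and `|φ̃''| ≤ γ̃`, then the
warped phase `θ = φ ∘ φ̃⁻¹` is `C²` and satisfies `|θ(t) − t| ≤ α`, `|θ'(t) − 1| ≤ β/H`
and `|θ''(t)| ≤ (γ + γ̃·θ'(t))/H²`. -/
theorem warped_phase_estimates
    (φ φt : ℝ → ℝ)
    (hφC2 : ContDiff ℝ 2 φ) (hφtC2 : ContDiff ℝ 2 φt)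
    (hφm : StrictMono φ) (hφtm : StrictMono φt)
    (hφb : Function.Bijective φ) (hφtb : Function.Bijective φt)
    (H α β γ γt : ℝ) (hH : 0 < H)
    (hα : 0 ≤ α) (hβ : 0 ≤ β) (hγ : 0 ≤ γ) (hγt : 0 ≤ γt)
    (hφt' : ∀ s : ℝ, H ≤ deriv φt s)
    (hval : ∀ s : ℝ, |φ s - φt s| ≤ α)
    (hder : ∀ s : ℝ, |deriv φ s - deriv φt s| ≤ β)
    (hφ'' : ∀ s : ℝ, |deriv (deriv φ) s| ≤ γ)
    (hφt'' : ∀ s : ℝ, |deriv (deriv φt) s| ≤ γt) :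
    ContDiff ℝ 2 (φ ∘ Function.invFun φt) ∧
    ∀ t : ℝ,
      |(φ ∘ Function.invFun φt) t - t| ≤ α ∧
      |deriv (φ ∘ Function.invFun φt) t - 1| ≤ β / H ∧
      |deriv (deriv (φ ∘ Function.invFun φt)) t|
        ≤ (γ + γt * deriv (φ ∘ Function.invFun φt) t) / H ^ 2 := by
  have hgC : ContDiff ℝ 2 (Function.invFun φt) := by
    let e : ℝ ≃o ℝ := StrictMono.orderIsoOfSurjective φt hφtm hφtb.2
    have he : ∀ x, e x = φt x := fun x => rfl
    have hg : Function.invFun φt = e.toHomeomorph.symm := by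
      funext t
      apply hφtb.1
      rw [Function.rightInverse_invFun hφtb.2 t]
      exact (e.apply_symm_apply t).symm
    rw [hg]
    refine Homeomorph.contDiff_symm_deriv e.toHomeomorph (f' := deriv φt)
      (fun x => (lt_of_lt_of_le hH (hφt' x)).ne') ?_ hφtC2
    intro x
    exact (hφtC2.differentiable (by norm_num) x).hasDerivAt
  have hinv : ∀ t, φt (Function.invFun φt t) = t := Function.rightInverse_invFun hφtb.2
  generalize Function.invFun φt = g at hgC hinv ⊢
  have hpos : ∀ s, 0 < deriv φt s := fun s => lt_of_lt_of_le hH (hφt' s)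
  have hφd : ∀ s, HasDerivAt φ (deriv φ s) s := fun s =>
    (hφC2.differentiable (by norm_num) s).hasDerivAt
  have hφtd : ∀ s, HasDerivAt φt (deriv φt s) s := fun s =>
    (hφtC2.differentiable (by norm_num) s).hasDerivAt
  have hφdd : ∀ s, HasDerivAt (deriv φ) (deriv (deriv φ) s) s := fun s =>
    (((contDiff_succ_iff_deriv (n := 1)).1 hφC2).2.2.differentiable (by norm_num) s).hasDerivAt
  have hφtdd : ∀ s, HasDerivAt (deriv φt) (deriv (deriv φt) s) s := fun s =>
    (((contDiff_succ_iff_deriv (n := 1)).1 hφtC2).2.2.differentiable (by norm_num) s).hasDerivAt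
  have hgd : ∀ t, HasDerivAt g (deriv φt (g t))⁻¹ t := fun t =>
    HasDerivAt.of_local_left_inverse hgC.continuous.continuousAt (hφtd (g t)) (hpos _).ne'
      (Filter.Eventually.of_forall hinv)
  have hθ : deriv (φ ∘ g) = fun t => deriv φ (g t) / deriv φt (g t) := by
    funext t
    rw [((hφd (g t)).comp t (hgd t)).deriv, div_eq_mul_inv]
  refine ⟨hφC2.comp hgC, fun t => ⟨?_, ?_, ?_⟩⟩
  · have := hval (g t)
    rwa [hinv] at this
  · rw [hθ]
    have h0 := hpos (g t)
    have : deriv φ (g t) / deriv φt (g t) - 1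
        = (deriv φ (g t) - deriv φt (g t)) / deriv φt (g t) := by
      field_simp
    simp only [this, abs_div, abs_of_pos h0]
    exact div_le_div₀ hβ (hder _) hH (hφt' _)
  · have h0 := hpos (g t)
    have hn : 0 ≤ deriv φ (g t) / deriv φt (g t) :=
      div_nonneg hφm.monotone.deriv_nonneg h0.le
    have h2 : deriv (deriv (φ ∘ g)) t = (deriv (deriv φ) (g t)
        - deriv (deriv φt) (g t) * (deriv φ (g t) / deriv φt (g t))) / deriv φt (g t) ^ 2 := by
      rw [hθ]
      have h3 := ((hφdd (g t)).comp t (hgd t)).div ((hφtdd (g t)).comp t (hgd t)) h0.ne'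
      refine h3.deriv.trans ?_
      simp only [Function.comp]
      field_simp
    rw [h2, hθ, abs_div, abs_of_pos (pow_pos h0 2)]
    refine div_le_div₀ (by positivity) ?_ (by positivity)
      (pow_le_pow_left₀ hH.le (hφt' _) 2)
    refine (abs_sub _ _).trans ?_
    rw [abs_mul, abs_of_nonneg hn]
    exact add_le_add (hφ'' _) (mul_le_mul_of_nonneg_right (hφt'' _) hn)
end
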